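/- arXiv:2104.05601 — 3 statements merged into one kernel-verified Lean document; each statement's English description precedes it below -/
import Mathlib

section
/- Gluing Lemma for proximity spaces: Let X, Y be metric spaces with the Čech–Lodato proximity, and let A, B be closed subsets of X with A ∪ B = X. If f : X → Y and g : X → Y are such that their restrictions to A and B respectively are proximally continuous in the sense that for all C, D ⊆ A, C δ D implies (f '' C) δ (f '' D), and for all C, D ⊆ B, C δ D implies (g '' C) δ (g '' D), and f(x) = g(x) for all x ∈ A ∩ B, then the map h : X → Y defined by h(x) = f(x) for x ∈ A and h(x) = g(x) for x ∈ B is proximally continuous: for all C, D ⊆ X, C δ D implies (h '' C) δ (h '' D). -/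
/-- Čech–Lodato proximity on a metric space: `A δ B` iff the closures intersect. -/
def cechLodato {X : Type*} [MetricSpace X] (A B : Set X) : Prop :=
  (closure A ∩ closure B).Nonempty

/-- Gluing Lemma for proximity spaces (Čech–Lodato proximity from a metric). -/
theorem stmt_1 {X Y : Type*} [MetricSpace X] [MetricSpace Y]
    (A B : Set X) (hA : IsClosed A) (hB : IsClosed B) (hAB : A ∪ B = Set.univ)
    (f g : X → Y)
    (hf : ∀ C D : Set X, C ⊆ A → D ⊆ A → cechLodato C D → cechLodato (f '' C) (f '' D))
    (hg : ∀ C D : Set X, C ⊆ B → D ⊆ B → cechLodato C D → cechLodato (g '' C) (g '' D))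
    (hfg : ∀ x ∈ A ∩ B, f x = g x)
    (h : X → Y)
    (hhf : ∀ x ∈ A, h x = f x) (hhg : ∀ x ∈ B, h x = g x) :
    ∀ C D : Set X, cechLodato C D → cechLodato (h '' C) (h '' D) := by
  have key : ∀ C : Set X, ∀ x ∈ closure C, h x ∈ closure (h '' C) := by
    have aux : ∀ (S : Set X) (k : X → Y), IsClosed S →
        (∀ C D : Set X, C ⊆ S → D ⊆ S → cechLodato C D → cechLodato (k '' C) (k '' D)) →
        (∀ x ∈ S, h x = k x) →
        ∀ C : Set X, ∀ x ∈ closure (C ∩ S), h x ∈ closure (h '' C) := by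
      intro S k hS hk hhk C x hx
      have hxS : x ∈ S := closure_minimal Set.inter_subset_right hS hx
      obtain ⟨y, hy1, hy2⟩ := hk {x} (C ∩ S) (Set.singleton_subset_iff.2 hxS)
        Set.inter_subset_right ⟨x, subset_closure rfl, hx⟩
      rw [Set.image_singleton, closure_singleton, Set.mem_singleton_iff] at hy1
      rw [hhk x hxS, ← hy1]
      refine closure_mono ?_ hy2
      rintro _ ⟨z, hz, rfl⟩
      exact ⟨z, hz.1, hhk z hz.2⟩
    intro C x hx
    have hC : C = (C ∩ A) ∪ (C ∩ B) := by
      rw [← Set.inter_union_distrib_left, hAB, Set.inter_univ]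
    rw [hC, closure_union] at hx
    rcases hx with hx | hx
    · exact aux A f hA hf hhf C x hx
    · exact aux B g hB hg hhg C x hx
  rintro C D ⟨x, hxC, hxD⟩
  exact ⟨h x, key C x hxC, key D x hxD⟩
end

section
/- Descriptive Gluing Lemma: Let X, Y be sets with probe functions Φ₁ : X → ℝⁿ, Φ₂ : Y → ℝᵐ, and let A, B ⊆ X be descriptively closed subsets (cl_{Φ₁} A = A and cl_{Φ₁} B = B) with A ∪ B = X. If f, g : X → Y satisfy: for all C, D ⊆ A, C δ_{Φ₁} D implies (f '' C) δ_{Φ₂} (f '' D); for all C, D ⊆ B, C δ_{Φ₁} D implies (g '' C) δ_{Φ₂} (g '' D); and f(x) = g(x) for all x ∈ A ∩ B; then the map h : X → Y defined by h(x) = f(x) for x ∈ A and h(x) = g(x) for x ∈ B is dpc: for all C, D ⊆ X, C δ_{Φ₁} D implies (h '' C) δ_{Φ₂} (h '' D). -/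
/-- Descriptive nearness relation induced by a probe function `Φ`. -/
def descNear {X : Type*} {n : ℕ} (Φ : X → EuclideanSpace ℝ (Fin n)) (A B : Set X) : Prop :=
  ∃ a ∈ A, ∃ b ∈ B, Φ a = Φ b

/-- Descriptive closure of a set `A` with respect to a probe function `Φ`. -/
def descClosure {X : Type*} {n : ℕ} (Φ : X → EuclideanSpace ℝ (Fin n)) (A : Set X) : Set X :=
  {x : X | Φ x ∈ Φ '' A}

/-- Descriptive Gluing Lemma. -/
theorem stmt_4 {X Y : Type*} {n m : ℕ}
    (Φ₁ : X → EuclideanSpace ℝ (Fin n)) (Φ₂ : Y → EuclideanSpace ℝ (Fin m))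
    (A B : Set X) (hA : descClosure Φ₁ A = A) (hB : descClosure Φ₁ B = B)
    (hAB : A ∪ B = Set.univ)
    (f g : X → Y)
    (hf : ∀ C D : Set X, C ⊆ A → D ⊆ A → descNear Φ₁ C D → descNear Φ₂ (f '' C) (f '' D))
    (hg : ∀ C D : Set X, C ⊆ B → D ⊆ B → descNear Φ₁ C D → descNear Φ₂ (g '' C) (g '' D))
    (hfg : ∀ x ∈ A ∩ B, f x = g x)
    (h : X → Y)
    (hhf : ∀ x ∈ A, h x = f x) (hhg : ∀ x ∈ B, h x = g x) :
    ∀ C D : Set X, descNear Φ₁ C D → descNear Φ₂ (h '' C) (h '' D) := by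
  rintro C D ⟨c, hc, d, hd, hcd⟩
  have hu : c ∈ A ∪ B := hAB ▸ Set.mem_univ c
  rcases hu with hcA | hcB
  · have hdA : d ∈ A := by
      rw [← hA]
      exact ⟨c, hcA, hcd⟩
    obtain ⟨_, ⟨x, rfl, rfl⟩, _, ⟨y, rfl, rfl⟩, e⟩ := hf {c} {d}
      (Set.singleton_subset_iff.2 hcA) (Set.singleton_subset_iff.2 hdA) ⟨c, rfl, d, rfl, hcd⟩
    exact ⟨h x, ⟨x, hc, rfl⟩, h y, ⟨y, hd, rfl⟩, by rw [hhf x hcA, hhf y hdA]; exact e⟩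
  · have hdB : d ∈ B := by
      rw [← hB]
      exact ⟨c, hcB, hcd⟩
    obtain ⟨_, ⟨x, rfl, rfl⟩, _, ⟨y, rfl, rfl⟩, e⟩ := hg {c} {d}
      (Set.singleton_subset_iff.2 hcB) (Set.singleton_subset_iff.2 hdB) ⟨c, rfl, d, rfl, hcd⟩
    exact ⟨h x, ⟨x, hc, rfl⟩, h y, ⟨y, hd, rfl⟩, by rw [hhg x hcB, hhg y hdB]; exact e⟩
end

section
/- Proximal homotopy is an equivalence relation: Let X, Y be metric spaces with the Čech–Lodato proximity, and give X × [0,1] the product metric and its Čech–Lodato proximity. Then the relation 'f is proximally homotopic to g' (written f ≃_δ g) is reflexive, symmetric, and transitive on the set of proximally continuous maps from X to Y. -/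
/-- Proximal continuity with respect to the Čech–Lodato proximities. -/
def ProxCont {X Y : Type*} [MetricSpace X] [MetricSpace Y] (f : X → Y) : Prop :=
  ∀ A B : Set X, cechLodato A B → cechLodato (f '' A) (f '' B)

/-- `f` and `g` are proximally homotopic: there is a proximally continuous
`H : X × [0,1] → Y` (product metric on `X × [0,1]`) with `H(x,0) = f x`, `H(x,1) = g x`. -/
def ProxHomotopic {X Y : Type*} [MetricSpace X] [MetricSpace Y] (f g : X → Y) : Prop :=
  ∃ H : X × unitInterval → Y, ProxCont H ∧ (∀ x, H (x, 0) = f x) ∧ (∀ x, H (x, 1) = g x)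

theorem proxCont_iff_continuous {X Y : Type*} [MetricSpace X] [MetricSpace Y] (f : X → Y) :
    ProxCont f ↔ Continuous f := by
  constructor
  · intro h
    rw [continuous_iff_isClosed]
    intro C hC
    refine isClosed_of_closure_subset ?_
    intro x hx
    obtain ⟨y, hy1, hy2⟩ := h {x} (f ⁻¹' C) ⟨x, subset_closure rfl, hx⟩
    rw [Set.image_singleton, closure_singleton] at hy1
    have hyx : y = f x := hy1
    subst hyx
    exact hC.closure_subset_iff.2 (Set.image_preimage_subset f C) hy2
  · rintro hf A B ⟨x, hA, hB⟩
    exact ⟨f x, image_closure_subset_closure_image hf ⟨x, hA, rfl⟩,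
      image_closure_subset_closure_image hf ⟨x, hB, rfl⟩⟩

theorem proxHomotopic_iff {X Y : Type*} [MetricSpace X] [MetricSpace Y] (f g : C(X, Y)) :
    ProxHomotopic f g ↔ ContinuousMap.Homotopic f g := by
  constructor
  · rintro ⟨H, hH, h0, h1⟩
    rw [proxCont_iff_continuous] at hH
    exact ⟨{ toFun := fun p => H (p.2, p.1)
             continuous_toFun := by fun_prop
             map_zero_left := h0
             map_one_left := h1 }⟩
  · rintro ⟨F⟩
    refine ⟨fun p => F (p.2, p.1), ?_, fun x => F.map_zero_left x, fun x => F.map_one_left x⟩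
    rw [proxCont_iff_continuous]
    fun_prop

/-- Proximal homotopy is reflexive, symmetric and transitive on the set of
proximally continuous maps. -/
theorem stmt_5 {X Y : Type*} [MetricSpace X] [MetricSpace Y] :
    (∀ f : X → Y, ProxCont f → ProxHomotopic f f) ∧
    (∀ f g : X → Y, ProxCont f → ProxCont g → ProxHomotopic f g → ProxHomotopic g f) ∧
    (∀ f g h : X → Y, ProxCont f → ProxCont g → ProxCont h →
      ProxHomotopic f g → ProxHomotopic g h → ProxHomotopic f h) := by
  simp only [proxCont_iff_continuous]
  refine ⟨fun f hf => ?_, fun f g hf hg hfg => ?_, fun f g h hf hg hh hfg hgh => ?_⟩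
  · exact (proxHomotopic_iff ⟨f, hf⟩ ⟨f, hf⟩).2 (ContinuousMap.Homotopic.refl _)
  · exact (proxHomotopic_iff ⟨g, hg⟩ ⟨f, hf⟩).2
      ((proxHomotopic_iff ⟨f, hf⟩ ⟨g, hg⟩).1 hfg).symm
  · exact (proxHomotopic_iff ⟨f, hf⟩ ⟨h, hh⟩).2
      (((proxHomotopic_iff ⟨f, hf⟩ ⟨g, hg⟩).1 hfg).trans
        ((proxHomotopic_iff ⟨g, hg⟩ ⟨h, hh⟩).1 hgh))
end
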